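/- arXiv:1807.03465 — 2 statements merged into one kernel-verified Lean document; each statement's English description precedes it below -/
import Mathlib

section
/- For every logconcave probability density p on ℝⁿ with finite second moment and every positive integer k, the k-th moment of the Euclidean norm satisfies E_{x∼p} ‖x‖₂^k ≤ (2k)^k · (E_{x∼p} ‖x‖₂²)^{k/2}. -/
open MeasureTheory Real Filter

noncomputable section

/-- A nonnegative function is logconcave if
`p (l • x + (1-l) • y) ≥ p x ^ l * p y ^ (1-l)` for all `x, y` and `l ∈ [0,1]`. -/
def IsLogConcave {n : ℕ} (p : EuclideanSpace ℝ (Fin n) → ℝ) : Prop :=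
  ∀ x y : EuclideanSpace ℝ (Fin n), ∀ l : ℝ, 0 ≤ l → l ≤ 1 →
    p x ^ l * p y ^ (1 - l) ≤ p (l • x + (1 - l) • y)

/-- `p` is a probability density on `ℝⁿ`. -/
def IsDensity {n : ℕ} (p : EuclideanSpace ℝ (Fin n) → ℝ) : Prop :=
  (∀ x, 0 ≤ p x) ∧ Integrable p ∧ (∫ x, p x) = 1

open scoped ENNReal

/-- The Brunn–Minkowski inequality on the real line. -/
theorem Real.volume_add_le_of_add_mem {A B C : Set ℝ} (hA : MeasurableSet A)
    (hB : MeasurableSet B) (hA0 : A.Nonempty) (hB0 : B.Nonempty)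
    (h : ∀ x ∈ A, ∀ y ∈ B, x + y ∈ C) : volume A + volume B ≤ volume C := by
  have compact_case : ∀ K L : Set ℝ, K ⊆ A → IsCompact K → K.Nonempty → L ⊆ B → IsCompact L →
      L.Nonempty → volume K + volume L ≤ volume C := by
    intro K L hKA hK hK0 hLB hL hL0
    have hsup := hK.sSup_mem hK0
    have hinf := hL.sInf_mem hL0
    have hdisj : AEDisjoint volume ((fun x => x + sInf L) '' K) ((fun y => sSup K + y) '' L) := by
      refine measure_mono_null (t := {sSup K + sInf L}) ?_ (by simp)
      rintro _ ⟨⟨x, hx, rfl⟩, ⟨y, hy, hxy⟩⟩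
      have h1 := le_csSup hK.bddAbove hx
      have h2 := csInf_le hL.bddBelow hy
      simp only [Set.mem_singleton_iff] at hxy ⊢
      linarith
    have hm : MeasurableSet ((fun y => sSup K + y) '' L) :=
      (hL.image (by fun_prop)).measurableSet
    calc volume K + volume L
        = volume ((fun x => x + sInf L) '' K) + volume ((fun y => sSup K + y) '' L) := by
          simp [Set.image_add_right, Set.image_add_left, measure_preimage_add_right,
            measure_preimage_add]
      _ = volume (((fun x => x + sInf L) '' K) ∪ ((fun y => sSup K + y) '' L)) :=
          (measure_union₀ hm.nullMeasurableSet hdisj).symm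
      _ ≤ volume C := by
          refine measure_mono ?_
          rintro _ (⟨x, hx, rfl⟩ | ⟨y, hy, rfl⟩)
          · exact h _ (hKA hx) _ (hLB hinf)
          · exact h _ (hKA hsup) _ (hLB hy)
  obtain ⟨x₀, hx₀⟩ := hA0
  obtain ⟨y₀, hy₀⟩ := hB0
  rw [hA.measure_eq_iSup_isCompact, hB.measure_eq_iSup_isCompact]
  simp only [iSup_and']
  refine ENNReal.biSup_add_biSup_le' ⟨∅, by simp⟩ ⟨∅, by simp⟩ fun K hK L hL => ?_
  refine le_trans (add_le_add (measure_mono (Set.subset_insert x₀ K))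
    (measure_mono (Set.subset_insert y₀ L))) ?_
  exact compact_case _ _ (Set.insert_subset hx₀ hK.1) (hK.2.insert _) (Set.insert_nonempty _ _)
    (Set.insert_subset hy₀ hL.1) (hL.2.insert _) (Set.insert_nonempty _ _)

theorem Real.weighted_volume_add_le {a b : ℝ} (ha : 0 < a) (hb : 0 < b) {A B C : Set ℝ}
    (hA : MeasurableSet A) (hB : MeasurableSet B) (hA0 : A.Nonempty) (hB0 : B.Nonempty)
    (h : ∀ x ∈ A, ∀ y ∈ B, a * x + b * y ∈ C) :
    ENNReal.ofReal a * volume A + ENNReal.ofReal b * volume B ≤ volume C := by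
  have key := Real.volume_add_le_of_add_mem (hA.const_smul₀ a) (hB.const_smul₀ b)
    (hA0.smul_set (a := a)) (hB0.smul_set (a := b)) (C := C) (by
      rintro _ ⟨x, hx, rfl⟩ _ ⟨y, hy, rfl⟩
      exact h x hx y hy)
  simpa [Measure.addHaar_smul, abs_of_pos ha, abs_of_pos hb] using key

/-- The layer cake formula for a function with values in `[0, 1]`. -/
theorem lintegral_eq_setLIntegral_Ioo_meas_lt {α : Type*} [MeasurableSpace α] {μ : Measure α}
    {u : α → ℝ≥0∞} (hu : Measurable u) (hu1 : ∀ x, u x ≤ 1) :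
    ∫⁻ x, u x ∂μ = ∫⁻ t in Set.Ioo (0 : ℝ) 1, μ {x | ENNReal.ofReal t < u x} := by
  have hfin : ∀ x, u x ≠ ∞ := fun x => ne_top_of_le_ne_top ENNReal.one_ne_top (hu1 x)
  have h1 : ∫⁻ x, u x ∂μ = ∫⁻ x, ENNReal.ofReal (u x).toReal ∂μ := by
    simp [ENNReal.ofReal_toReal (hfin _)]
  rw [h1, lintegral_eq_lintegral_meas_lt μ (Eventually.of_forall fun _ => ENNReal.toReal_nonneg)
    hu.ennreal_toReal.aemeasurable, ← lintegral_indicator measurableSet_Ioi,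
    ← lintegral_indicator measurableSet_Ioo]
  refine lintegral_congr fun t => ?_
  by_cases ht0 : 0 < t
  · by_cases ht1 : t < 1
    · simp [ht0, ht1, ENNReal.ofReal_lt_iff_lt_toReal ht0.le (hfin _)]
    · have : ∀ x, ¬ t < (u x).toReal := fun x hx =>
        ht1 (hx.trans_le (ENNReal.toReal_mono ENNReal.one_ne_top (hu1 x)))
      simp [ht0, ht1, this]
  · simp [ht0]

/-- The one-dimensional Prékopa–Leindler inequality for functions with supremum one,
in its arithmetic-mean form. -/
theorem weighted_lintegral_add_le_of_sup_eq_one {a b : ℝ} (ha : 0 < a) (hb : 0 < b)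
    (hab : a + b = 1) {f g h : ℝ → ℝ≥0∞} (hf : Measurable f) (hg : Measurable g)
    (hh : Measurable h) (hf1 : ∀ x, f x ≤ 1) (hg1 : ∀ x, g x ≤ 1)
    (hfs : ∀ t < 1, ∃ x, t < f x) (hgs : ∀ t < 1, ∃ x, t < g x)
    (hfgh : ∀ x y, f x ^ a * g y ^ b ≤ h (a * x + b * y)) :
    ENNReal.ofReal a * (∫⁻ x, f x) + ENNReal.ofReal b * (∫⁻ x, g x) ≤ ∫⁻ x, h x := by
  refine le_trans ?_ (lintegral_mono fun x => min_le_left (h x) 1)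
  rw [lintegral_eq_setLIntegral_Ioo_meas_lt hf hf1, lintegral_eq_setLIntegral_Ioo_meas_lt hg hg1,
    lintegral_eq_setLIntegral_Ioo_meas_lt (hh.min measurable_const) fun _ => min_le_right _ _,
    ← lintegral_const_mul' _ _ ENNReal.ofReal_ne_top,
    ← lintegral_const_mul' _ _ ENNReal.ofReal_ne_top, ← lintegral_add_left]
  · refine setLIntegral_mono' measurableSet_Ioo fun t ht => ?_
    have ht1 : ENNReal.ofReal t < 1 := by simpa using ht.2
    refine Real.weighted_volume_add_le ha hb (measurableSet_lt measurable_const hf)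
      (measurableSet_lt measurable_const hg) (hfs _ ht1) (hgs _ ht1) fun x hx y hy => ?_
    refine lt_min (lt_of_lt_of_le ?_ (hfgh x y)) ht1
    calc ENNReal.ofReal t = ENNReal.ofReal t ^ a * ENNReal.ofReal t ^ b := by
          rw [← ENNReal.rpow_add_of_nonneg _ _ ha.le hb.le, hab, ENNReal.rpow_one]
      _ < _ := ENNReal.mul_lt_mul (ENNReal.rpow_lt_rpow hx ha) (ENNReal.rpow_lt_rpow hy hb)
  · refine Measurable.const_mul (Antitone.measurable fun s t hst => measure_mono fun x hx => ?_) _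
    exact lt_of_le_of_lt (ENNReal.ofReal_le_ofReal hst) hx

theorem ENNReal.rpow_mul_rpow_le_weighted_add {a b : ℝ} (ha : 0 < a) (hb : 0 < b)
    (hab : a + b = 1) (x y : ℝ≥0∞) :
    x ^ a * y ^ b ≤ ENNReal.ofReal a * x + ENNReal.ofReal b * y := by
  rcases eq_or_ne x ∞ with rfl | hx
  · simp [ENNReal.mul_top, ha]
  rcases eq_or_ne y ∞ with rfl | hy
  · simp [ENNReal.mul_top, hb]
  lift x to NNReal using hx
  lift y to NNReal using hy
  have key := NNReal.geom_mean_le_arith_mean2_weighted a.toNNReal b.toNNReal x y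
    (by rw [← Real.toNNReal_add ha.le hb.le, hab, Real.toNNReal_one])
  rw [Real.coe_toNNReal a ha.le, Real.coe_toNNReal b hb.le] at key
  rw [← ENNReal.coe_rpow_of_nonneg _ ha.le, ← ENNReal.coe_rpow_of_nonneg _ hb.le,
    ENNReal.ofReal, ENNReal.ofReal]
  exact_mod_cast key

theorem prekopaLeindler_real_of_iSup_ne_top {a b : ℝ} (ha : 0 < a) (hb : 0 < b)
    (hab : a + b = 1) {f g h : ℝ → ℝ≥0∞} (hf : Measurable f) (hg : Measurable g)
    (hh : Measurable h) (hft : ⨆ x, f x ≠ ∞) (hgt : ⨆ x, g x ≠ ∞)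
    (hfgh : ∀ x y, f x ^ a * g y ^ b ≤ h (a * x + b * y)) :
    (∫⁻ x, f x) ^ a * (∫⁻ x, g x) ^ b ≤ ∫⁻ x, h x := by
  rcases eq_or_ne (⨆ x, f x) 0 with hf0 | hf0
  · simp [ENNReal.iSup_eq_zero.1 hf0, ha]
  rcases eq_or_ne (⨆ x, g x) 0 with hg0 | hg0
  · simp [ENNReal.iSup_eq_zero.1 hg0, hb]
  set F := ⨆ x, f x
  set G := ⨆ x, g x
  have exists_lt : ∀ {u : ℝ → ℝ≥0∞}, ⨆ x, u x ≠ 0 → ⨆ x, u x ≠ ∞ →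
      ∀ t < 1, ∃ x, t < u x / ⨆ x, u x := by
    intro u hu0 hut t ht
    have : t * (⨆ x, u x) < ⨆ x, u x := by
      simpa using ENNReal.mul_lt_mul_left hu0 hut ht
    obtain ⟨x, hx⟩ := lt_iSup_iff.1 this
    exact ⟨x, (ENNReal.lt_div_iff_mul_lt (Or.inl hu0) (Or.inl hut)).2 hx⟩
  have hFa0 : F ^ a ≠ 0 := by simp [hf0, ha.le]
  have hFat : F ^ a ≠ ∞ := ENNReal.rpow_ne_top_of_nonneg ha.le hft
  have hGb0 : G ^ b ≠ 0 := by simp [hg0, hb.le]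
  have hGbt : G ^ b ≠ ∞ := ENNReal.rpow_ne_top_of_nonneg hb.le hgt
  have key := weighted_lintegral_add_le_of_sup_eq_one ha hb hab (hf.div_const F) (hg.div_const G)
    (hh.div_const (F ^ a * G ^ b))
    (fun x => ENNReal.div_le_of_le_mul (by simpa using le_iSup f x))
    (fun x => ENNReal.div_le_of_le_mul (by simpa using le_iSup g x))
    (exists_lt hf0 hft) (exists_lt hg0 hgt) fun x y => by
      rw [ENNReal.div_rpow_of_nonneg _ _ ha.le, ENNReal.div_rpow_of_nonneg _ _ hb.le,
        ← ENNReal.mul_div_mul_comm (Or.inl hFa0) (Or.inl hFat)]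
      exact ENNReal.div_le_div_right (hfgh x y) _
  have key' := (ENNReal.rpow_mul_rpow_le_weighted_add ha hb hab _ _).trans key
  simp only [div_eq_mul_inv] at key'
  rw [lintegral_mul_const _ hf, lintegral_mul_const _ hg, lintegral_mul_const _ hh] at key'
  rw [← div_eq_mul_inv, ← div_eq_mul_inv, ← div_eq_mul_inv,
    ENNReal.div_rpow_of_nonneg _ _ ha.le, ENNReal.div_rpow_of_nonneg _ _ hb.le] at key'
  rwa [← ENNReal.mul_div_mul_comm (Or.inl hFa0) (Or.inl hFat),
    ENNReal.div_le_iff (mul_ne_zero hFa0 hGb0) (ENNReal.mul_ne_top hFat hGbt),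
    ENNReal.div_mul_cancel (mul_ne_zero hFa0 hGb0) (ENNReal.mul_ne_top hFat hGbt)] at key'

theorem tendsto_lintegral_min_natCast {α : Type*} [MeasurableSpace α] {μ : Measure α}
    {f : α → ℝ≥0∞} (hf : Measurable f) :
    Tendsto (fun N : ℕ => ∫⁻ x, min (f x) N ∂μ) atTop (nhds (∫⁻ x, f x ∂μ)) := by
  refine lintegral_tendsto_of_tendsto_of_monotone
    (fun N => (hf.min measurable_const).aemeasurable)
    (Eventually.of_forall fun x M N hMN => min_le_min le_rfl (by exact_mod_cast hMN))
    (Eventually.of_forall fun x => ?_)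
  simpa using (tendsto_const_nhds (x := f x)).min ENNReal.tendsto_nat_nhds_top

/-- The Prékopa–Leindler inequality on the real line. -/
theorem prekopaLeindler_real {a b : ℝ} (ha : 0 < a) (hb : 0 < b)
    (hab : a + b = 1) {f g h : ℝ → ℝ≥0∞} (hf : Measurable f) (hg : Measurable g)
    (hh : Measurable h) (hfgh : ∀ x y, f x ^ a * g y ^ b ≤ h (a * x + b * y)) :
    (∫⁻ x, f x) ^ a * (∫⁻ x, g x) ^ b ≤ ∫⁻ x, h x := by
  rcases eq_or_ne (∫⁻ x, f x) 0 with hf0 | hf0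
  · simp [hf0, ha]
  rcases eq_or_ne (∫⁻ x, g x) 0 with hg0 | hg0
  · simp [hg0, hb]
  have hlim := ENNReal.Tendsto.mul
    ((tendsto_lintegral_min_natCast (μ := volume) hf).ennrpow_const a)
    (Or.inl (by simp [hf0, ha.le]))
    ((tendsto_lintegral_min_natCast (μ := volume) hg).ennrpow_const b)
    (Or.inl (by simp [hg0, hb.le]))
  refine le_of_tendsto' hlim fun N => ?_
  have hsup : ∀ u : ℝ → ℝ≥0∞, ⨆ x, min (u x) (N : ℝ≥0∞) ≠ ∞ := fun u =>
    ne_top_of_le_ne_top (ENNReal.natCast_ne_top N) (iSup_le fun _ => min_le_right _ _)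
  refine prekopaLeindler_real_of_iSup_ne_top ha hb hab (hf.min measurable_const)
    (hg.min measurable_const) hh (hsup f) (hsup g) fun x y => le_trans ?_ (hfgh x y)
  gcongr <;> exact min_le_left _ _

/-- The Prékopa–Leindler inequality on `Fin n → ℝ`. -/
theorem prekopaLeindler_pi {a b : ℝ} (ha : 0 < a) (hb : 0 < b) (hab : a + b = 1) (n : ℕ)
    {f g h : (Fin n → ℝ) → ℝ≥0∞} (hf : Measurable f) (hg : Measurable g)
    (hh : Measurable h) (hfgh : ∀ x y, f x ^ a * g y ^ b ≤ h (a • x + b • y)) :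
    (∫⁻ x, f x) ^ a * (∫⁻ x, g x) ^ b ≤ ∫⁻ x, h x := by
  induction n with
  | zero =>
    simpa [volume_pi, Measure.pi_of_empty (x := 0), lintegral_dirac' _ hf, lintegral_dirac' _ hg,
      lintegral_dirac' _ hh] using hfgh 0 0
  | succ n ih =>
    let e := MeasurableEquiv.piFinSuccAbove (fun _ : Fin (n + 1) => ℝ) 0
    have he : MeasurePreserving e.symm :=
      (volume_preserving_piFinSuccAbove (fun _ : Fin (n + 1) => ℝ) 0).symm
    have fubini : ∀ u : (Fin (n + 1) → ℝ) → ℝ≥0∞, Measurable u →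
        ∫⁻ x, u x = ∫⁻ t : ℝ, ∫⁻ y : Fin n → ℝ, u (e.symm (t, y)) := by
      intro u hu
      rw [← he.lintegral_comp hu]
      exact lintegral_prod _ (hu.comp e.symm.measurable).aemeasurable
    have hsymm : ∀ (s t : ℝ) (x y : Fin n → ℝ),
        e.symm (a * s + b * t, a • x + b • y) = a • e.symm (s, x) + b • e.symm (t, y) := by
      intro s t x y
      ext i
      refine Fin.cases ?_ (fun j => ?_) i <;>
        simp [e, MeasurableEquiv.piFinSuccAbove, Fin.insertNthEquiv]
    have slice : ∀ u : (Fin (n + 1) → ℝ) → ℝ≥0∞, Measurable u → ∀ t : ℝ,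
        Measurable fun y : Fin n → ℝ => u (e.symm (t, y)) := fun u hu t =>
      hu.comp (e.symm.measurable.comp measurable_prodMk_left)
    have marginal : ∀ u : (Fin (n + 1) → ℝ) → ℝ≥0∞, Measurable u →
        Measurable fun t : ℝ => ∫⁻ y : Fin n → ℝ, u (e.symm (t, y)) := fun u hu =>
      (hu.comp e.symm.measurable).lintegral_prod_right'
    rw [fubini f hf, fubini g hg, fubini h hh]
    refine prekopaLeindler_real ha hb hab (marginal f hf) (marginal g hg) (marginal h hh)
      fun s t => ih (slice f hf s) (slice g hg t) (slice h hh _) fun x y => ?_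
    rw [hsymm]
    exact hfgh _ _

/-- The Prékopa–Leindler inequality on Euclidean space. -/
theorem prekopaLeindler_euclideanSpace {a b : ℝ} (ha : 0 < a) (hb : 0 < b) (hab : a + b = 1)
    {n : ℕ} {f g h : EuclideanSpace ℝ (Fin n) → ℝ≥0∞} (hf : Measurable f) (hg : Measurable g)
    (hh : Measurable h) (hfgh : ∀ x y, f x ^ a * g y ^ b ≤ h (a • x + b • y)) :
    (∫⁻ x, f x) ^ a * (∫⁻ x, g x) ^ b ≤ ∫⁻ x, h x := by
  have e := PiLp.volume_preserving_toLp (Fin n)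
  rw [← e.lintegral_comp hf, ← e.lintegral_comp hg, ← e.lintegral_comp hh]
  exact prekopaLeindler_pi ha hb hab n (hf.comp e.measurable) (hg.comp e.measurable)
    (hh.comp e.measurable) fun x y => hfgh _ _

/-- A measure with logconcave density is logconcave. -/
theorem IsLogConcave.withDensity_rpow_mul_rpow_le {n : ℕ} {p : EuclideanSpace ℝ (Fin n) → ℝ}
    (hlc : IsLogConcave p) (hp0 : ∀ x, 0 ≤ p x) (hpm : AEMeasurable p)
    {a b : ℝ} (ha : 0 < a) (hb : 0 < b) (hab : a + b = 1)
    {A B C : Set (EuclideanSpace ℝ (Fin n))} (hA : MeasurableSet A) (hB : MeasurableSet B)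
    (hC : MeasurableSet C) (hABC : ∀ x ∈ A, ∀ y ∈ B, a • x + b • y ∈ C) :
    (volume.withDensity fun x => ENNReal.ofReal (p x)) A ^ a *
      (volume.withDensity fun x => ENNReal.ofReal (p x)) B ^ b ≤
      (volume.withDensity fun x => ENNReal.ofReal (p x)) C := by
  let q : EuclideanSpace ℝ (Fin n) → ℝ≥0∞ := fun x => ENNReal.ofReal (hpm.mk p x)
  have hq : Measurable q := hpm.measurable_mk.ennreal_ofReal
  let N := toMeasurable volume {x | p x ≠ hpm.mk p x}
  have hN : MeasurableSet N := measurableSet_toMeasurable _ _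
  have hN0 : volume N = 0 := by
    rw [measure_toMeasurable]
    exact hpm.ae_eq_mk
  have hqp : ∀ x ∉ N, q x = ENNReal.ofReal (p x) := by
    intro x hx
    have : p x = hpm.mk p x := by
      by_contra h
      exact hx (subset_toMeasurable _ _ h)
    simp [q, ← this]
  have hN_ae : ∀ᵐ x ∂(volume : Measure (EuclideanSpace ℝ (Fin n))), x ∉ N :=
    measure_eq_zero_iff_ae_notMem.1 hN0
  have apply_eq : ∀ S : Set (EuclideanSpace ℝ (Fin n)), MeasurableSet S →
      (volume.withDensity fun x => ENNReal.ofReal (p x)) S = ∫⁻ x, (S \ N).indicator q x := by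
    intro S hS
    rw [withDensity_apply _ hS, ← lintegral_indicator hS]
    refine lintegral_congr_ae ?_
    filter_upwards [hN_ae] with x hx
    by_cases hxS : x ∈ S <;> simp [hxS, hx, hqp]
  have lintegral_top : ∫⁻ x, N.indicator (fun _ => ∞) x = 0 := by
    simp [lintegral_indicator hN, hN0]
  calc _ = (∫⁻ x, (A \ N).indicator q x) ^ a * (∫⁻ x, (B \ N).indicator q x) ^ b := by
        rw [apply_eq A hA, apply_eq B hB]
    _ ≤ ∫⁻ x, ((C \ N).indicator q x + N.indicator (fun _ => ∞) x) := by
        refine prekopaLeindler_euclideanSpace ha hb hab (hq.indicator (hA.diff hN))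
          (hq.indicator (hB.diff hN))
          ((hq.indicator (hC.diff hN)).add (measurable_const.indicator hN)) fun x y => ?_
        by_cases hx : x ∈ A \ N
        swap
        · simp [Set.indicator_of_notMem hx, ha]
        by_cases hy : y ∈ B \ N
        swap
        · simp [Set.indicator_of_notMem hy, hb]
        by_cases hz : a • x + b • y ∈ N
        · simp [hz]
        rw [Set.indicator_of_mem hx, Set.indicator_of_mem hy,
          Set.indicator_of_mem (Set.mem_sdiff_of_mem (hABC x hx.1 y hy.1) hz), hqp _ hx.2, hqp _ hy.2, hqp _ hz,
          ENNReal.ofReal_rpow_of_nonneg (hp0 x) ha.le, ENNReal.ofReal_rpow_of_nonneg (hp0 y) hb.le,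
          ← ENNReal.ofReal_mul (rpow_nonneg (hp0 x) a)]
        refine le_add_right (ENNReal.ofReal_le_ofReal ?_)
        obtain rfl : b = 1 - a := by linarith
        exact hlc x y a ha.le (by linarith)
    _ = _ := by
        rw [lintegral_add_left (hq.indicator (hC.diff hN)), lintegral_top, add_zero, apply_eq C hC]

/-- Exponential decay of the norm under a logconcave probability measure (Borell's lemma),
at the scale where the norm exceeds `3 * σ` with probability at most `1 / 9`. -/
theorem measureReal_norm_gt_le_exp {n : ℕ} {μ : Measure (EuclideanSpace ℝ (Fin n))}
    [IsProbabilityMeasure μ]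
    (hμ : ∀ a b : ℝ, 0 < a → 0 < b → a + b = 1 → ∀ A B C : Set (EuclideanSpace ℝ (Fin n)),
      MeasurableSet A → MeasurableSet B → MeasurableSet C →
      (∀ x ∈ A, ∀ y ∈ B, a • x + b • y ∈ C) → μ A ^ a * μ B ^ b ≤ μ C)
    {σ : ℝ} (hσ : 0 < σ) (h9 : μ.real {x | 3 * σ < ‖x‖} ≤ 1 / 9) {s : ℝ} (hs : 3 < s) :
    μ.real {x | s * σ < ‖x‖} ≤ exp (-(s / 3)) := by
  have hs3 : 0 < s + 3 := by linarith
  set a : ℝ := 6 / (s + 3) with ha_def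
  set b : ℝ := (s - 3) / (s + 3) with hb_def
  have ha : 0 < a := by positivity
  have hb : 0 < b := div_pos (by linarith) hs3
  have hab : a + b = 1 := by
    rw [ha_def, hb_def]
    field_simp
    ring
  have meas_gt : ∀ r : ℝ, MeasurableSet {x : EuclideanSpace ℝ (Fin n) | r < ‖x‖} := fun r =>
    measurableSet_lt measurable_const measurable_norm
  have key := hμ a b ha hb hab {x | s * σ < ‖x‖} {x | 3 * σ < ‖x‖}ᶜ {x | 3 * σ < ‖x‖}
    (meas_gt _) (meas_gt _).compl (meas_gt _) (by
      intro x hx y hy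
      simp only [Set.mem_ofPred_eq, Set.mem_compl_iff, not_lt] at hx hy ⊢
      have h1 : a * ‖x‖ - b * ‖y‖ ≤ ‖a • x + b • y‖ := by
        have := norm_sub_le (a • x + b • y) (b • y)
        rw [add_sub_cancel_right, norm_smul, norm_smul, norm_of_nonneg ha.le,
          norm_of_nonneg hb.le] at this
        linarith
      have h2 : a * (s * σ) - b * (3 * σ) = 3 * σ := by
        rw [ha_def, hb_def]
        field_simp
        ring
      nlinarith [mul_lt_mul_of_pos_left hx ha, mul_le_mul_of_nonneg_left hy hb.le])
  have key' : μ.real {x | s * σ < ‖x‖} ^ a * μ.real {x | 3 * σ < ‖x‖}ᶜ ^ b ≤ 1 / 9 := by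
    refine le_trans ?_ h9
    have := ENNReal.toReal_mono (measure_ne_top μ _) key
    rwa [ENNReal.toReal_mul, ← ENNReal.toReal_rpow, ← ENNReal.toReal_rpow] at this
  have hB : 8 / 9 ≤ μ.real {x | 3 * σ < ‖x‖}ᶜ := by
    rw [probReal_compl_eq_one_sub (meas_gt _)]
    linarith
  have hBb : 8 / 9 ≤ μ.real {x | 3 * σ < ‖x‖}ᶜ ^ b :=
    hB.trans (self_le_rpow_of_le_one measureReal_nonneg measureReal_le_one (by linarith))
  set T := μ.real {x | s * σ < ‖x‖}
  have hT0 : 0 ≤ T := measureReal_nonneg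
  have hTa : T ^ a ≤ exp (-2) := by
    have h8 : T ^ a ≤ 1 / 8 := by
      nlinarith [mul_le_mul_of_nonneg_left hBb (rpow_nonneg hT0 a)]
    have he : exp 2 ≤ 8 := by
      have h1 := exp_one_lt_d9
      have h2 : exp 2 = exp 1 * exp 1 := by rw [← exp_add]; norm_num
      nlinarith [exp_pos 1]
    rw [exp_neg]
    refine h8.trans ?_
    rw [one_div]
    exact inv_anti₀ (exp_pos 2) he
  calc T = (T ^ a) ^ a⁻¹ := (rpow_rpow_inv hT0 ha.ne').symm
    _ ≤ exp (-2) ^ a⁻¹ := rpow_le_rpow (rpow_nonneg hT0 a) hTa (by positivity)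
    _ = exp (-((s + 3) / 3)) := by
        rw [← exp_mul, ha_def]
        congr 1
        field_simp
        ring
    _ ≤ exp (-(s / 3)) := exp_le_exp.2 (by linarith)

/-- Moment bound for a random variable with exponentially decaying tail beyond `3`. -/
theorem lintegral_pow_le_of_tail_le_exp {Ω : Type*} [MeasurableSpace Ω] {μ : Measure Ω}
    [IsProbabilityMeasure μ] {Y : Ω → ℝ} (hY : Measurable Y) (hY0 : ∀ ω, 0 ≤ Y ω)
    (htail : ∀ s, 3 < s → μ.real {ω | s < Y ω} ≤ exp (-(s / 3))) {k : ℕ} (hk : 0 < k) :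
    ∫⁻ ω, ENNReal.ofReal (Y ω ^ k) ∂μ ≤ ENNReal.ofReal (3 ^ k * (1 + k.factorial)) := by
  have hk' : (0 : ℝ) < k := by exact_mod_cast hk
  have hpow : Measurable fun t : ℝ => ENNReal.ofReal (t ^ ((k : ℝ) - 1)) := by fun_prop
  have h1 : ∫⁻ t in Set.Ioc (0 : ℝ) 3, ENNReal.ofReal (t ^ ((k : ℝ) - 1)) =
      ENNReal.ofReal (3 ^ k / k) := by
    rw [← ofReal_integral_eq_lintegral_ofReal, ← intervalIntegral.integral_of_le (by norm_num : (0 : ℝ) ≤ 3),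
      integral_rpow (Or.inl (by linarith))]
    · simp [zero_rpow hk'.ne']
    · exact (intervalIntegral.intervalIntegrable_rpow' (by linarith)).1
    · filter_upwards [self_mem_ae_restrict
        (measurableSet_Ioc : MeasurableSet (Set.Ioc (0 : ℝ) 3))] with t ht
      exact rpow_nonneg ht.1.le _
  have h2 : ∫⁻ t in Set.Ioi (0 : ℝ), ENNReal.ofReal (t ^ ((k : ℝ) - 1) * exp (-((1 / 3) * t))) =
      ENNReal.ofReal (3 ^ k * Gamma k) := by
    have hI := integral_rpow_mul_exp_neg_mul_Ioi hk' (r := 1 / 3) (by norm_num)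
    rw [← ofReal_integral_eq_lintegral_ofReal, hI]
    · simp
    · refine Integrable.of_integral_ne_zero ?_
      rw [hI]
      have := Gamma_pos_of_pos hk'
      positivity
    · filter_upwards [self_mem_ae_restrict
        (measurableSet_Ioi : MeasurableSet (Set.Ioi (0 : ℝ)))] with t ht
      exact mul_nonneg (rpow_nonneg (le_of_lt ht) _) (exp_pos _).le
  have hlayer := lintegral_rpow_eq_lintegral_meas_lt_mul μ (Eventually.of_forall hY0)
    hY.aemeasurable hk'
  simp only [rpow_natCast] at hlayer
  rw [hlayer]
  calc ENNReal.ofReal k * ∫⁻ t in Set.Ioi (0 : ℝ), μ {ω | t < Y ω} *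
        ENNReal.ofReal (t ^ ((k : ℝ) - 1))
      ≤ ENNReal.ofReal k * ∫⁻ t in Set.Ioi (0 : ℝ),
          ((Set.Ioc (0 : ℝ) 3).indicator (fun t => ENNReal.ofReal (t ^ ((k : ℝ) - 1))) t +
            ENNReal.ofReal (t ^ ((k : ℝ) - 1) * exp (-((1 / 3) * t)))) := by
        refine mul_le_mul' le_rfl (setLIntegral_mono' measurableSet_Ioi fun t ht => ?_)
        by_cases ht3 : t ≤ 3
        · rw [Set.indicator_of_mem (Set.mem_Ioc.2 ⟨ht, ht3⟩)]
          exact le_add_right (mul_le_of_le_one_left zero_le prob_le_one)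
        · refine le_add_left ?_
          rw [mul_comm, ENNReal.ofReal_mul (rpow_nonneg (le_of_lt ht) _)]
          gcongr
          rw [← ofReal_measureReal]
          refine ENNReal.ofReal_le_ofReal ((htail t (not_le.1 ht3)).trans_eq ?_)
          ring_nf
    _ = ENNReal.ofReal k * (ENNReal.ofReal (3 ^ k / k) + ENNReal.ofReal (3 ^ k * Gamma k)) := by
        rw [lintegral_add_left (hpow.indicator measurableSet_Ioc), h2,
          lintegral_indicator measurableSet_Ioc, Measure.restrict_restrict measurableSet_Ioc,
          Set.inter_eq_self_of_subset_left Set.Ioc_subset_Ioi_self, h1]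
    _ = ENNReal.ofReal (3 ^ k * (1 + k.factorial)) := by
        have hG := Gamma_pos_of_pos hk'
        rw [← ENNReal.ofReal_add (by positivity) (by positivity), ← ENNReal.ofReal_mul hk'.le,
          ← Gamma_nat_eq_factorial, Gamma_add_one hk'.ne']
        congr 1
        field_simp

theorem three_pow_mul_one_add_factorial_le {k : ℕ} (hk : 3 ≤ k) :
    (3 : ℝ) ^ k * (1 + k.factorial) ≤ (2 * (k : ℝ)) ^ k := by
  induction k, hk using Nat.le_induction with
  | base => norm_num [Nat.factorial]
  | succ k hk ih =>
    have hk' : (3 : ℝ) ≤ k := by exact_mod_cast hk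
    have bernoulli : 2 * (k : ℝ) ^ k ≤ (k + 1) ^ k := by
      have h := one_add_mul_le_pow (a := (1 : ℝ) / k) ((by norm_num : (-2 : ℝ) ≤ 0).trans (by positivity)) k
      have h2 : (1 : ℝ) + k * (1 / k) = 2 := by field_simp; norm_num
      rw [h2] at h
      calc 2 * (k : ℝ) ^ k ≤ (1 + 1 / k) ^ k * k ^ k := by gcongr
        _ = (k + 1) ^ k := by rw [← mul_pow]; congr 1; field_simp
    calc (3 : ℝ) ^ (k + 1) * (1 + (k + 1).factorial)
        ≤ 4 * (k + 1) * (3 ^ k * (1 + k.factorial)) := by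
          rw [Nat.factorial_succ, pow_succ]
          push_cast
          have : (0 : ℝ) < 3 ^ k := by positivity
          have hf : (0 : ℝ) < k.factorial := by positivity
          have : (3 : ℝ) * (1 + (k + 1) * k.factorial) ≤ 4 * (k + 1) * (1 + k.factorial) := by
            nlinarith
          nlinarith
      _ ≤ 4 * (k + 1) * (2 * (k : ℝ)) ^ k := by gcongr
      _ = 2 * (k + 1) * 2 ^ k * (2 * (k : ℝ) ^ k) := by rw [mul_pow]; ring
      _ ≤ 2 * (k + 1) * 2 ^ k * (k + 1) ^ k := by gcongr
      _ = (2 * ((k + 1 : ℕ) : ℝ)) ^ (k + 1) := by push_cast; rw [mul_pow]; ring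

/-- logconcave moments: for every logconcave probability density `p` on `ℝⁿ`
with finite second moment and every positive integer `k`,
`E ‖x‖^k ≤ (2k)^k (E ‖x‖²)^{k/2}`. -/
theorem logconcave_moment_bound
    (n : ℕ) (p : EuclideanSpace ℝ (Fin n) → ℝ) (k : ℕ)
    (hp : IsDensity p) (hlc : IsLogConcave p)
    (hmom : Integrable (fun x : EuclideanSpace ℝ (Fin n) => p x * ‖x‖ ^ 2))
    (hk : 0 < k) :
    (∫ x, p x * ‖x‖ ^ k) ≤
      (2 * (k : ℝ)) ^ k * (∫ x, p x * ‖x‖ ^ 2) ^ ((k : ℝ) / 2) := by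
  obtain ⟨hp0, hpi, hp1⟩ := hp
  have hnn : ∀ x, 0 ≤ p x * ‖x‖ ^ 2 := fun x => mul_nonneg (hp0 x) (by positivity)
  set M := ∫ x, p x * ‖x‖ ^ 2 with hM
  have hM0 : 0 ≤ M := integral_nonneg hnn
  rcases hM0.eq_or_lt with hM0 | hMpos
  · have hae := (integral_eq_zero_iff_of_nonneg hnn hmom).1 (hM.symm.trans hM0.symm)
    have hzero : ∫ x, p x * ‖x‖ ^ k = 0 := integral_eq_zero_of_ae <| by
      filter_upwards [hae] with x hx
      have : p x = 0 ∨ x = 0 := by simpa using hx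
      rcases this with h | h <;> simp [h, hk.ne']
    rw [hzero]
    exact mul_nonneg (by positivity) (rpow_nonneg hM0.le _)
  set σ := √M with hσ_def
  have hσ : 0 < σ := sqrt_pos.2 hMpos
  have hσsq : σ ^ 2 = M := sq_sqrt hMpos.le
  have hMpow : M ^ ((k : ℝ) / 2) = σ ^ k := by
    rw [← hσsq, ← rpow_natCast σ 2, ← rpow_mul hσ.le, ← rpow_natCast σ k]
    congr 1
    push_cast
    ring
  rw [hMpow]
  rcases (show k = 1 ∨ k = 2 ∨ 3 ≤ k by omega) with rfl | rfl | hk3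
  · calc ∫ x, p x * ‖x‖ ^ 1 ≤ ∫ x, ((p x * ‖x‖ ^ 2) * (1 / (2 * σ)) + p x * (σ / 2)) := by
          refine integral_mono_of_nonneg (Eventually.of_forall fun x => ?_)
            ((hmom.mul_const _).add (hpi.mul_const _)) (Eventually.of_forall fun x => ?_)
          · exact mul_nonneg (hp0 x) (by positivity)
          · have : ‖x‖ ^ 1 ≤ ‖x‖ ^ 2 * (1 / (2 * σ)) + σ / 2 := by
              have h : ‖x‖ ^ 2 * (1 / (2 * σ)) + σ / 2 - ‖x‖ ^ 1 = (‖x‖ - σ) ^ 2 / (2 * σ) := by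
                field_simp
                ring
              have : 0 ≤ (‖x‖ - σ) ^ 2 / (2 * σ) := by positivity
              linarith
            calc p x * ‖x‖ ^ 1 ≤ p x * (‖x‖ ^ 2 * (1 / (2 * σ)) + σ / 2) :=
                  mul_le_mul_of_nonneg_left this (hp0 x)
              _ = _ := by ring
      _ = σ := by
          rw [integral_add (hmom.mul_const _) (hpi.mul_const _), integral_mul_const,
            integral_mul_const, hp1, ← hM, ← hσsq]
          field_simp
          ring
      _ ≤ (2 * ((1 : ℕ) : ℝ)) ^ 1 * σ ^ 1 := by
          norm_num
          linarith
  · rw [hσsq, ← hM]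
    norm_num
    linarith
  let μ : Measure (EuclideanSpace ℝ (Fin n)) := volume.withDensity fun x => ENNReal.ofReal (p x)
  have lintegral_eq : ∀ u : EuclideanSpace ℝ (Fin n) → ℝ, Measurable u →
      ∫⁻ x, ENNReal.ofReal (u x) ∂μ = ∫⁻ x, ENNReal.ofReal (p x * u x) := by
    intro u hu
    rw [lintegral_withDensity_eq_lintegral_mul₀ hpi.aemeasurable.ennreal_ofReal
      hu.ennreal_ofReal.aemeasurable]
    simp [ENNReal.ofReal_mul (hp0 _)]
  have : IsProbabilityMeasure μ := ⟨by
    rw [withDensity_apply _ MeasurableSet.univ, Measure.restrict_univ, ← ofReal_integral_eq_lintegral_ofReal hpi (Eventually.of_forall hp0), hp1,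
      ENNReal.ofReal_one]⟩
  have hmarkov : μ.real {x | 3 * σ < ‖x‖} ≤ 1 / 9 := by
    have h := mul_meas_ge_le_lintegral₀ (μ := μ) (f := fun x => ENNReal.ofReal (‖x‖ ^ 2))
      (by fun_prop) (ENNReal.ofReal (9 * M))
    rw [lintegral_eq _ (by fun_prop),
      ← ofReal_integral_eq_lintegral_ofReal hmom (Eventually.of_forall hnn), ← hM] at h
    have h' := (mul_le_mul_right (measure_mono (μ := μ) (s := {x | 3 * σ < ‖x‖}) fun x hx => by
      refine ENNReal.ofReal_le_ofReal ?_
      have hx : 3 * σ < ‖x‖ := hx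
      nlinarith) _).trans h
    rw [← ofReal_measureReal, ← ENNReal.ofReal_mul (by positivity),
      ENNReal.ofReal_le_ofReal_iff hMpos.le] at h'
    nlinarith
  have htail : ∀ s, 3 < s → μ.real {x | s < ‖x‖ / σ} ≤ exp (-(s / 3)) := by
    intro s hs
    simp only [lt_div_iff₀ hσ]
    exact measureReal_norm_gt_le_exp (fun a b ha hb hab A B C hA hB hC hABC =>
      hlc.withDensity_rpow_mul_rpow_le hp0 hpi.aemeasurable ha hb hab hA hB hC hABC) hσ hmarkov hs
  have hmoment := lintegral_pow_le_of_tail_le_exp (μ := μ) (Y := fun x => ‖x‖ / σ) (by fun_prop)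
    (fun x => by positivity) htail hk
  rw [lintegral_eq _ (by fun_prop)] at hmoment
  have hscaled : ∫ x, p x * (‖x‖ / σ) ^ k ≤ (2 * (k : ℝ)) ^ k := by
    rw [integral_eq_lintegral_of_nonneg_ae
      (Eventually.of_forall fun x => mul_nonneg (hp0 x) (by positivity))
      (hpi.aestronglyMeasurable.mul (by fun_prop))]
    exact (ENNReal.toReal_le_of_le_ofReal (by positivity) hmoment).trans
      (three_pow_mul_one_add_factorial_le hk3)
  calc ∫ x, p x * ‖x‖ ^ k = (∫ x, p x * (‖x‖ / σ) ^ k) * σ ^ k := by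
        rw [← integral_mul_const]
        congr 1 with x
        rw [div_pow, mul_assoc, div_mul_cancel₀ _ (pow_pos hσ k).ne']
    _ ≤ (2 * (k : ℝ)) ^ k * σ ^ k := by gcongr
end
end

section
/- There is a universal constant C > 0 such that for every logconcave probability density p on ℝⁿ with mean μ and covariance matrix A, one has ‖E_{x∼p} [(x−μ)·((x−μ)ᵀ A (x−μ))]‖₂ ≤ C · ‖A‖_op^{1/2} · tr(A²), where the expectation is a vector in ℝⁿ and ‖·‖₂ denotes its Euclidean norm. -/
open MeasureTheory Real Filter

noncomputable section

/-- The mean (barycenter) of the density `p`. -/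
def meanOf {n : ℕ} (p : EuclideanSpace ℝ (Fin n) → ℝ) : EuclideanSpace ℝ (Fin n) :=
  ∫ x, p x • x

/-- The covariance matrix of the density `p`. -/
def covOf {n : ℕ} (p : EuclideanSpace ℝ (Fin n) → ℝ) : Matrix (Fin n) (Fin n) ℝ :=
  Matrix.of fun i j => ∫ x, p x * ((x i - meanOf p i) * (x j - meanOf p j))

/-- The largest eigenvalue (spectral norm) of a symmetric PSD matrix, expressed as the
supremum of the quadratic form over unit vectors. -/
def largestEigenvalue {n : ℕ} (A : Matrix (Fin n) (Fin n) ℝ) : ℝ :=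
  sSup {r : ℝ | ∃ v : Fin n → ℝ, (∑ i, (v i) ^ 2) = 1 ∧ r = ∑ i, ∑ j, v i * A i j * v j}

open scoped ENNReal NNReal

/-- One-dimensional Brunn–Minkowski for nonempty compact sets. -/
lemma IsCompact.volume_add_volume_le {K L S : Set ℝ} (hK : IsCompact K) (hL : IsCompact L)
    (hK0 : K.Nonempty) (hL0 : L.Nonempty) (hS : ∀ x ∈ K, ∀ y ∈ L, x + y ∈ S) :
    volume K + volume L ≤ volume S := by
  obtain ⟨a, haK, ha⟩ := hK.exists_isGreatest hK0
  obtain ⟨b, hbL, hb⟩ := hL.exists_isLeast hL0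
  have h1 : volume ((fun x => x + -b) ⁻¹' K) = volume K := measure_preimage_add_right _ _ _
  have h2 : volume ((fun x => x + -a) ⁻¹' L) = volume L := measure_preimage_add_right _ _ _
  have hm : MeasurableSet ((fun x => x + -a) ⁻¹' L) :=
    (measurable_add_const (-a)) hL.measurableSet
  have hd : AEDisjoint volume ((fun x => x + -b) ⁻¹' K) ((fun x => x + -a) ⁻¹' L) := by
    refine measure_mono_null (t := {a + b}) ?_ (by simp)
    rintro x ⟨hx1, hx2⟩
    have := ha hx1
    have := hb hx2
    simp only [Set.mem_singleton_iff]
    linarith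
  rw [← h1, ← h2, ← measure_union₀ hm.nullMeasurableSet hd]
  refine measure_mono ?_
  rintro x (hx | hx)
  · simpa using hS _ hx _ hbL
  · simpa using hS _ haK _ hx

/-- One-dimensional Brunn–Minkowski for nonempty measurable sets. -/
lemma MeasurableSet.volume_add_volume_le {A B S : Set ℝ} (hA : MeasurableSet A)
    (hB : MeasurableSet B) (hA0 : A.Nonempty) (hB0 : B.Nonempty)
    (hS : ∀ x ∈ A, ∀ y ∈ B, x + y ∈ S) :
    volume A + volume B ≤ volume S := by
  obtain ⟨a, ha⟩ := hA0
  obtain ⟨b, hb⟩ := hB0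
  rw [hA.measure_eq_iSup_isCompact, hB.measure_eq_iSup_isCompact]
  simp only [iSup_and']
  refine ENNReal.biSup_add_biSup_le' ⟨∅, by simp⟩ ⟨∅, by simp⟩ fun K hK L hL => ?_
  refine (add_le_add (measure_mono (Set.subset_insert a K))
    (measure_mono (Set.subset_insert b L))).trans ?_
  refine (hK.2.insert a).volume_add_volume_le (hL.2.insert b) (by simp) (by simp)
    fun x hx y hy => hS x ?_ y ?_
  · rcases hx with rfl | hx
    exacts [ha, hK.1 hx]
  · rcases hy with rfl | hy
    exacts [hb, hL.1 hy]

lemma volume_add_volume_le_of_midpoint {A B S : Set ℝ} (hA : MeasurableSet A)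
    (hB : MeasurableSet B) (hA0 : A.Nonempty) (hB0 : B.Nonempty)
    (hS : ∀ x ∈ A, ∀ y ∈ B, (x + y) / 2 ∈ S) :
    volume A + volume B ≤ 2 * volume S := by
  have := hA.volume_add_volume_le hB hA0 hB0 (S := (fun x => (2⁻¹ : ℝ) * x) ⁻¹' S)
    (fun x hx y hy => by simpa [div_eq_inv_mul] using hS x hx y hy)
  rw [Real.volume_preimage_mul_left (by norm_num)] at this
  simpa using this

/-- One-dimensional Prékopa–Leindler, for functions with supremum one. -/
lemma lintegral_add_lintegral_le_of_superlevel {f g h : ℝ → ℝ} (hf : Measurable f)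
    (hg : Measurable g) (hh : Measurable h) (hf0 : 0 ≤ f) (hg0 : 0 ≤ g) (hh0 : 0 ≤ h)
    (hf1 : ∀ x, f x ≤ 1) (hg1 : ∀ x, g x ≤ 1)
    (hf2 : ∀ t < 1, ∃ x, t < f x) (hg2 : ∀ t < 1, ∃ x, t < g x)
    (hfg : ∀ x y, f x * g y ≤ h ((x + y) / 2) ^ 2) :
    (∫⁻ x, ENNReal.ofReal (f x)) + ∫⁻ x, ENNReal.ofReal (g x)
      ≤ 2 * ∫⁻ x, ENNReal.ofReal (h x) := by
  rw [lintegral_eq_lintegral_meas_lt _ (.of_forall hf0) hf.aemeasurable,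
    lintegral_eq_lintegral_meas_lt _ (.of_forall hg0) hg.aemeasurable,
    lintegral_eq_lintegral_meas_lt _ (.of_forall hh0) hh.aemeasurable,
    ← lintegral_add_right', ← lintegral_const_mul']
  · refine setLIntegral_mono' measurableSet_Ioi fun t ht => ?_
    rw [Set.mem_Ioi] at ht
    rcases lt_or_ge t 1 with h1 | h1
    · refine volume_add_volume_le_of_midpoint (measurableSet_lt measurable_const hf)
        (measurableSet_lt measurable_const hg) (hf2 t h1) (hg2 t h1) fun x hx y hy => ?_
      simp only [Set.mem_ofPred_eq] at hx hy ⊢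
      have := hfg x y
      have := hh0 ((x + y) / 2)
      simp only [Pi.zero_apply] at this
      by_contra! hc
      nlinarith [mul_lt_mul'' hx hy ht.le ht.le]
    · have e1 : {a | t < f a} = ∅ := by
        ext a; simp only [Set.mem_ofPred_eq, Set.mem_empty_iff_false, iff_false, not_lt]
        exact (hf1 a).trans h1
      have e2 : {a | t < g a} = ∅ := by
        ext a; simp only [Set.mem_ofPred_eq, Set.mem_empty_iff_false, iff_false, not_lt]
        exact (hg1 a).trans h1
      simp [e1, e2]
  · simp
  · refine AEMeasurable.restrict (Antitone.measurable fun s t hst => ?_).aemeasurable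
    exact measure_mono fun x hx => lt_of_le_of_lt hst hx

lemma lintegral_mul_lintegral_le_of_bounded {f g h : ℝ → ℝ≥0∞} (hf : Measurable f)
    (hg : Measurable g) (hh : Measurable h) {m : ℝ≥0∞} (hm : m ≠ ∞)
    (hfm : ∀ x, f x ≤ m) (hgm : ∀ x, g x ≤ m) (hhm : ∀ x, h x ≤ m)
    (hfg : ∀ x y, f x * g y ≤ h ((x + y) / 2) ^ 2) :
    (∫⁻ x, f x) * ∫⁻ x, g x ≤ (∫⁻ x, h x) ^ 2 := by
  set a := ⨆ x, f x with ha
  set b := ⨆ x, g x with hb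
  have hat : a ≠ ∞ := ne_top_of_le_ne_top hm (iSup_le hfm)
  have hbt : b ≠ ∞ := ne_top_of_le_ne_top hm (iSup_le hgm)
  rcases eq_or_ne a 0 with ha0 | ha0
  · have : ∀ x, f x = 0 := by simpa [ha] using ha0
    simp [this]
  rcases eq_or_ne b 0 with hb0 | hb0
  · have : ∀ x, g x = 0 := by simpa [hb] using hb0
    simp [this]
  set s : ℝ≥0∞ := (a * b) ^ (1 / 2 : ℝ) with hs
  have hs2 : s ^ 2 = a * b := by
    rw [hs, ← ENNReal.rpow_natCast, ← ENNReal.rpow_mul]; simp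
  have hab0 : a * b ≠ 0 := mul_ne_zero ha0 hb0
  have habt : a * b ≠ ∞ := ENNReal.mul_ne_top hat hbt
  have hs0 : s ≠ 0 := by rintro h; rw [h] at hs2; simp at hs2; tauto
  have hfa : ∀ x, f x / a ≤ 1 := fun x => ENNReal.div_le_of_le_mul (by simpa using le_iSup f x)
  have hgb : ∀ x, g x / b ≤ 1 := fun x => ENNReal.div_le_of_le_mul (by simpa using le_iSup g x)
  have hht : ∀ x, h x / s ≠ ∞ := fun x =>
    ENNReal.div_ne_top (ne_top_of_le_ne_top hm (hhm x)) hs0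
  have hft : ∀ x, f x / a ≠ ∞ := fun x => ne_top_of_le_ne_top ENNReal.one_ne_top (hfa x)
  have hgt : ∀ x, g x / b ≠ ∞ := fun x => ne_top_of_le_ne_top ENNReal.one_ne_top (hgb x)
  have approx : ∀ (u : ℝ → ℝ≥0∞), (⨆ x, u x) ≠ 0 → (⨆ x, u x) ≠ ∞ →
      ∀ t < (1 : ℝ), ∃ x, t < (u x / ⨆ x, u x).toReal := by
    intro u hu0 hut t ht
    have h1 : ENNReal.ofReal (max t 0) * (⨆ x, u x) < ⨆ x, u x := by
      conv_rhs => rw [← one_mul (⨆ x, u x)]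
      exact ENNReal.mul_lt_mul_left hu0 hut (by simpa using ht)
    obtain ⟨x, hx⟩ := lt_iSup_iff.1 h1
    refine ⟨x, (le_max_left t 0).trans_lt
      ((ENNReal.ofReal_lt_iff_lt_toReal (le_max_right t 0) ?_).1 ?_)⟩
    · exact ENNReal.div_ne_top (ne_top_of_le_ne_top hut (le_iSup u x)) hu0
    · exact (ENNReal.lt_div_iff_mul_lt (.inl hu0) (.inl hut)).2 hx
  have key := lintegral_add_lintegral_le_of_superlevel
    (f := fun x => (f x / a).toReal) (g := fun x => (g x / b).toReal)
    (h := fun x => (h x / s).toReal) (hf.div_const a).ennreal_toReal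
    (hg.div_const b).ennreal_toReal (hh.div_const s).ennreal_toReal
    (fun x => ENNReal.toReal_nonneg) (fun x => ENNReal.toReal_nonneg)
    (fun x => ENNReal.toReal_nonneg)
    (fun x => ENNReal.toReal_le_of_le_ofReal zero_le_one (by simpa using hfa x))
    (fun x => ENNReal.toReal_le_of_le_ofReal zero_le_one (by simpa using hgb x))
    (approx f ha0 hat) (approx g hb0 hbt) (fun x y => by
      rw [← ENNReal.toReal_mul, ← ENNReal.toReal_pow]
      refine ENNReal.toReal_mono (ENNReal.pow_ne_top (hht _)) ?_
      rw [div_eq_mul_inv, div_eq_mul_inv, div_eq_mul_inv, mul_pow, ← ENNReal.inv_pow, hs2,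
        ENNReal.mul_inv (.inl ha0) (.inl hat), mul_mul_mul_comm]
      gcongr
      exact hfg x y)
  simp only [ENNReal.ofReal_toReal (hft _),
    ENNReal.ofReal_toReal (hgt _),
    ENNReal.ofReal_toReal (hht _)] at key
  simp only [div_eq_mul_inv] at key
  rw [lintegral_mul_const _ hf, lintegral_mul_const _ hg, lintegral_mul_const _ hh] at key
  have amgm : ∀ X Y Z : ℝ≥0∞, X + Y ≤ 2 * Z → X * Y ≤ Z ^ 2 := by
    intro X Y Z h
    rcases eq_or_ne Z ∞ with rfl | hZ
    · simp
    have h2 : (2 : ℝ≥0∞) * Z ≠ ∞ := ENNReal.mul_ne_top (by simp) hZ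
    have hX : X ≠ ∞ := ne_top_of_le_ne_top h2 (le_self_add.trans h)
    have hY : Y ≠ ∞ := ne_top_of_le_ne_top h2 (le_add_self.trans h)
    lift X to ℝ≥0 using hX
    lift Y to ℝ≥0 using hY
    lift Z to ℝ≥0 using hZ
    norm_cast at h ⊢
    have h' : (X : ℝ) + Y ≤ 2 * Z := by exact_mod_cast h
    rw [← NNReal.coe_le_coe]
    push_cast
    nlinarith [sq_nonneg ((X : ℝ) - Y), X.coe_nonneg, Y.coe_nonneg, Z.coe_nonneg]
  have := amgm _ _ _ key
  rw [mul_pow, ← ENNReal.inv_pow, hs2, mul_mul_mul_comm, ← ENNReal.mul_inv (.inl ha0) (.inl hat)]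
    at this
  exact (ENNReal.mul_le_mul_iff_left (ENNReal.inv_ne_zero.2 habt) (ENNReal.inv_ne_top.2 hab0)).1 this

/-- One-dimensional Prékopa–Leindler inequality at the midpoint. -/
lemma lintegral_mul_lintegral_le_sq_real {f g h : ℝ → ℝ≥0∞} (hf : Measurable f)
    (hg : Measurable g) (hh : Measurable h)
    (hfg : ∀ x y, f x * g y ≤ h ((x + y) / 2) ^ 2) :
    (∫⁻ x, f x) * ∫⁻ x, g x ≤ (∫⁻ x, h x) ^ 2 := by
  have trunc : ∀ u : ℝ → ℝ≥0∞, Measurable u →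
      ∫⁻ x, u x = ⨆ k : ℕ, ∫⁻ x, min (u x) k := by
    intro u hu
    rw [← lintegral_iSup (fun k => hu.min measurable_const)
      (fun i j hij x => min_le_min le_rfl (by exact_mod_cast hij))]
    congr with x
    rw [← inf_iSup_eq, ENNReal.iSup_natCast, inf_top_eq]
  have mono : ∀ (u : ℝ → ℝ≥0∞) {i j : ℕ}, i ≤ j →
      ∫⁻ x, min (u x) i ≤ ∫⁻ x, min (u x) j := fun u i j hij =>
    lintegral_mono fun x => min_le_min le_rfl (by exact_mod_cast hij)
  rw [trunc f hf, trunc g hg]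
  simp only [ENNReal.iSup_mul, ENNReal.mul_iSup, iSup_le_iff]
  intro i j
  refine (mul_le_mul' (mono f (le_max_left j i)) (mono g (le_max_right j i))).trans ?_
  generalize max j i = k
  refine (lintegral_mul_lintegral_le_of_bounded (h := fun x => min (h x) k)
    (hf.min measurable_const) (hg.min measurable_const) (hh.min measurable_const)
    (ENNReal.natCast_ne_top k) (fun x => min_le_right _ _) (fun x => min_le_right _ _)
    (fun x => min_le_right _ _) fun x y => ?_).trans
    (pow_le_pow_left' (lintegral_mono fun x => min_le_left _ _) 2)
  rcases le_total (h ((x + y) / 2)) k with hk | hk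
  · rw [min_eq_left hk]
    exact (mul_le_mul' (min_le_left _ _) (min_le_left _ _)).trans (hfg x y)
  · rw [min_eq_right hk, sq]
    exact mul_le_mul' (min_le_right _ _) (min_le_right _ _)

/-- Prékopa–Leindler inequality at the midpoint on `Fin n → ℝ`. -/
lemma lintegral_mul_lintegral_le_sq_pi (n : ℕ) {f g h : (Fin n → ℝ) → ℝ≥0∞} (hf : Measurable f)
    (hg : Measurable g) (hh : Measurable h)
    (hfg : ∀ x y, f x * g y ≤ h ((2⁻¹ : ℝ) • (x + y)) ^ 2) :
    (∫⁻ x, f x) * ∫⁻ x, g x ≤ (∫⁻ x, h x) ^ 2 := by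
  induction n with
  | zero =>
    have e : ∀ u : (Fin 0 → ℝ) → ℝ≥0∞, ∫⁻ x, u x = u 0 := fun u => by
      rw [lintegral_unique, volume_pi, Measure.pi_of_empty, measure_univ, mul_one]
      exact congrArg u (Subsingleton.elim _ _)
    simpa [e] using hfg 0 0
  | succ n ih =>
    let e := (MeasurableEquiv.piFinSuccAbove (fun _ : Fin (n + 1) => ℝ) 0).symm
    have he : MeasurePreserving e := (volume_preserving_piFinSuccAbove _ 0).symm
    have eq : ∀ u : (Fin (n + 1) → ℝ) → ℝ≥0∞, Measurable u →
        ∫⁻ x, u x = ∫⁻ s, ∫⁻ z, u (e (s, z)) := fun u hu => by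
      rw [← he.lintegral_comp hu, Measure.volume_eq_prod, lintegral_prod]
      exact (hu.comp e.measurable).aemeasurable
    have meas : ∀ u : (Fin (n + 1) → ℝ) → ℝ≥0∞, Measurable u →
        Measurable fun q : ℝ × (Fin n → ℝ) => u (e q) := fun u hu => hu.comp e.measurable
    have meas' : ∀ u : (Fin (n + 1) → ℝ) → ℝ≥0∞, Measurable u → ∀ s,
        Measurable fun z : Fin n → ℝ => u (e (s, z)) := fun u hu s =>
      (meas u hu).comp measurable_prodMk_left
    rw [eq f hf, eq g hg, eq h hh]
    refine lintegral_mul_lintegral_le_sq_real (meas f hf).lintegral_prod_right'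
      (meas g hg).lintegral_prod_right' (meas h hh).lintegral_prod_right' fun s t => ?_
    refine ih (meas' f hf s) (meas' g hg t) (meas' h hh _) fun x y => ?_
    convert hfg (e (s, x)) (e (t, y)) using 3
    ext i
    refine Fin.cases ?_ (fun i => ?_) i <;>
      simp [e, MeasurableEquiv.piFinSuccAbove, div_eq_inv_mul, mul_add]

/-- Prékopa–Leindler inequality at the midpoint on `ℝⁿ`. -/
lemma lintegral_mul_lintegral_le_sq {n : ℕ} {f g h : EuclideanSpace ℝ (Fin n) → ℝ≥0∞}
    (hf : Measurable f) (hg : Measurable g) (hh : Measurable h)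
    (hfg : ∀ x y, f x * g y ≤ h ((2⁻¹ : ℝ) • (x + y)) ^ 2) :
    (∫⁻ x, f x) * ∫⁻ x, g x ≤ (∫⁻ x, h x) ^ 2 := by
  have hm := PiLp.volume_preserving_toLp (Fin n)
  rw [← hm.lintegral_comp hf, ← hm.lintegral_comp hg, ← hm.lintegral_comp hh]
  exact lintegral_mul_lintegral_le_sq_pi n (hf.comp hm.measurable) (hg.comp hm.measurable)
    (hh.comp hm.measurable) fun x y => hfg _ _

lemma IsLogConcave.mul_le_sq_midpoint {n : ℕ} {p : EuclideanSpace ℝ (Fin n) → ℝ}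
    (hp : IsLogConcave p) (hp0 : ∀ x, 0 ≤ p x) (x y : EuclideanSpace ℝ (Fin n)) :
    p x * p y ≤ p ((2⁻¹ : ℝ) • (x + y)) ^ 2 := by
  have h := hp x y (1 / 2) (by norm_num) (by norm_num)
  have e : (1 / 2 : ℝ) • x + (1 - 1 / 2 : ℝ) • y = (2⁻¹ : ℝ) • (x + y) := by
    rw [smul_add]; norm_num
  rw [e, show (1 - 1 / 2 : ℝ) = 1 / 2 by norm_num, ← Real.sqrt_eq_rpow, ← Real.sqrt_eq_rpow] at h
  calc p x * p y = (√(p x) * √(p y)) ^ 2 := by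
        rw [mul_pow, Real.sq_sqrt (hp0 x), Real.sq_sqrt (hp0 y)]
    _ ≤ _ := pow_le_pow_left₀ (by positivity) h 2

/-- A measure with logconcave density satisfies the Brunn–Minkowski inequality at the midpoint. -/
lemma IsLogConcave.measure_mul_measure_le {n : ℕ} {p : EuclideanSpace ℝ (Fin n) → ℝ}
    (hp : IsLogConcave p) (hp0 : ∀ x, 0 ≤ p x) (hpm : AEMeasurable p)
    {A B S : Set (EuclideanSpace ℝ (Fin n))}
    (hA : MeasurableSet A) (hB : MeasurableSet B) (hS : MeasurableSet S)
    (hABS : ∀ x ∈ A, ∀ y ∈ B, (2⁻¹ : ℝ) • (x + y) ∈ S) :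
    (volume.withDensity fun x => ENNReal.ofReal (p x)) A *
      (volume.withDensity fun x => ENNReal.ofReal (p x)) B ≤
      (volume.withDensity fun x => ENNReal.ofReal (p x)) S ^ 2 := by
  set N := toMeasurable volume {x | p x ≠ hpm.mk p x}
  have hNm : MeasurableSet N := measurableSet_toMeasurable _ _
  have hN0 : volume N = 0 := by rw [measure_toMeasurable]; exact hpm.ae_eq_mk
  have hN : ∀ x ∉ N, hpm.mk p x = p x := fun x hx => by
    by_contra h
    exact hx (subset_toMeasurable _ _ (Ne.symm h))
  set P : EuclideanSpace ℝ (Fin n) → ℝ≥0∞ := fun x => ENNReal.ofReal (hpm.mk p x)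
  have hP : Measurable P := hpm.measurable_mk.ennreal_ofReal
  have hNae : ∀ᵐ x, x ∉ N := measure_eq_zero_iff_ae_notMem.1 hN0
  have low : ∀ T, MeasurableSet T →
      (volume.withDensity fun x => ENNReal.ofReal (p x)) T = ∫⁻ x, (T \ N).indicator P x := by
    intro T hT
    rw [withDensity_apply _ hT, ← lintegral_indicator hT]
    refine lintegral_congr_ae ?_
    filter_upwards [hNae] with x hx
    by_cases hxT : x ∈ T <;> simp [hxT, hx, P, hN]
  have up : (volume.withDensity fun x => ENNReal.ofReal (p x)) S =
      ∫⁻ x, (N.indicator (fun _ => ∞) x + S.indicator P x) := by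
    rw [withDensity_apply _ hS, ← lintegral_indicator hS]
    refine lintegral_congr_ae ?_
    filter_upwards [hNae] with x hx
    by_cases hxT : x ∈ S <;> simp [hxT, hx, P, hN]
  rw [low A hA, low B hB, up]
  refine lintegral_mul_lintegral_le_sq (hP.indicator (hA.diff hNm)) (hP.indicator (hB.diff hNm))
    ((measurable_const.indicator hNm).add (hP.indicator hS)) fun x y => ?_
  by_cases hx : x ∈ A \ N
  swap
  · simp [Set.indicator_of_notMem hx]
  by_cases hy : y ∈ B \ N
  swap
  · simp [Set.indicator_of_notMem hy]
  by_cases hz : (2⁻¹ : ℝ) • (x + y) ∈ N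
  · rw [Set.indicator_of_mem hz]; simp
  rw [Set.indicator_of_mem hx, Set.indicator_of_mem hy, Set.indicator_of_notMem hz,
    Set.indicator_of_mem (hABS x hx.1 y hy.1), zero_add]
  simp only [P, hN x hx.2, hN y hy.2, hN _ hz]
  rw [← ENNReal.ofReal_mul (hp0 x), ← ENNReal.ofReal_pow (hp0 _)]
  exact ENNReal.ofReal_le_ofReal (hp.mul_le_sq_midpoint hp0 x y)

section Moments

variable {Ω : Type*} [MeasurableSpace Ω] {ν : Measure Ω} [IsProbabilityMeasure ν]

lemma measureReal_three_pow_le {φ : Ω → ℝ} (hφ : Measurable φ)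
    (H : ∀ t : ℝ, 0 < t → ν {x | 3 * t ≤ |φ x|} * ν {x | |φ x| < t} ≤ ν {x | t ≤ |φ x|} ^ 2)
    (h1 : ν.real {x | 1 ≤ |φ x|} ≤ 1 / 324) (k : ℕ) :
    ν.real {x | 3 ^ k ≤ |φ x|} ≤ 1 / 324 * (1 / 162) ^ k := by
  induction k with
  | zero => simpa using h1
  | succ k ih =>
    have hk := ENNReal.toReal_mono (by finiteness) (H (3 ^ k) (by positivity))
    rw [ENNReal.toReal_mul, ENNReal.toReal_pow, ← pow_succ'] at hk
    have hc : ν.real {x | |φ x| < 3 ^ k} = 1 - ν.real {x | 3 ^ k ≤ |φ x|} := by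
      rw [← probReal_compl_eq_one_sub (measurableSet_le measurable_const hφ.abs)]
      congr 1; ext x; simp
    simp only [← measureReal_def, hc] at hk
    have hp1 : (1 / 162 : ℝ) ^ k ≤ 1 := pow_le_one₀ (by norm_num) (by norm_num)
    have hq0 : 0 ≤ ν.real {x | 3 ^ k ≤ |φ x|} := measureReal_nonneg
    have hr0 : 0 ≤ ν.real {x | 3 ^ (k + 1) ≤ |φ x|} := measureReal_nonneg
    rw [pow_succ (1 / 162 : ℝ)]
    nlinarith

lemma lintegral_pow_four_le_of_tail {φ : Ω → ℝ} (hφ : Measurable φ)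
    (H : ∀ t : ℝ, 0 < t → ν {x | 3 * t ≤ |φ x|} * ν {x | |φ x| < t} ≤ ν {x | t ≤ |φ x|} ^ 2)
    (h1 : ν.real {x | 1 ≤ |φ x|} ≤ 1 / 324) :
    ∫⁻ x, ENNReal.ofReal (φ x ^ 4) ∂ν ≤ ENNReal.ofReal 2 := by
  have hms : ∀ k : ℕ, MeasurableSet {x | (3 : ℝ) ^ k ≤ |φ x|} := fun k =>
    measurableSet_le measurable_const hφ.abs
  have pt : ∀ x, ENNReal.ofReal (φ x ^ 4) ≤ 1 + ∑' k : ℕ,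
      {x | (3 : ℝ) ^ k ≤ |φ x|}.indicator (fun _ => ENNReal.ofReal (81 ^ (k + 1))) x := by
    intro x
    rw [← Even.pow_abs (by decide : Even 4)]
    rcases lt_or_ge |φ x| 1 with h | h
    · refine le_add_right (ENNReal.ofReal_le_one.2 (pow_le_one₀ (abs_nonneg _) h.le))
    · obtain ⟨k, hk1, hk2⟩ := exists_nat_pow_near h (by norm_num : (1 : ℝ) < 3)
      refine le_add_left (le_trans ?_ (ENNReal.le_tsum k))
      rw [Set.indicator_of_mem (by exact hk1)]
      refine ENNReal.ofReal_le_ofReal ?_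
      calc |φ x| ^ 4 ≤ (3 ^ (k + 1)) ^ 4 := pow_le_pow_left₀ (abs_nonneg _) hk2.le 4
        _ = 81 ^ (k + 1) := by rw [← pow_mul, mul_comm, pow_mul]; norm_num
  calc ∫⁻ x, ENNReal.ofReal (φ x ^ 4) ∂ν
      ≤ ∫⁻ x, (1 + ∑' k : ℕ, {x | (3 : ℝ) ^ k ≤ |φ x|}.indicator
          (fun _ => ENNReal.ofReal (81 ^ (k + 1))) x) ∂ν := lintegral_mono pt
    _ = 1 + ∑' k : ℕ, ENNReal.ofReal (81 ^ (k + 1)) * ν {x | (3 : ℝ) ^ k ≤ |φ x|} := by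
        rw [lintegral_add_left measurable_const, lintegral_tsum
          fun k => (measurable_const.indicator (hms k)).aemeasurable]
        simp [lintegral_indicator_const (hms _)]
    _ ≤ 1 + ∑' k : ℕ, ENNReal.ofReal (1 / 4 * (1 / 2) ^ k) := by
        gcongr with k
        rw [← ofReal_measureReal, ← ENNReal.ofReal_mul (by positivity)]
        refine ENNReal.ofReal_le_ofReal ?_
        calc (81 : ℝ) ^ (k + 1) * ν.real {x | (3 : ℝ) ^ k ≤ |φ x|}
            ≤ 81 ^ (k + 1) * (1 / 324 * (1 / 162) ^ k) := by
              gcongr; exact measureReal_three_pow_le hφ H h1 k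
          _ = 1 / 4 * (81 * (1 / 162)) ^ k := by rw [mul_pow, pow_succ]; ring
          _ = 1 / 4 * (1 / 2) ^ k := by norm_num
    _ = 1 + ENNReal.ofReal (1 / 2) := by
        rw [← ENNReal.ofReal_tsum_of_nonneg (fun k => by positivity)
          (summable_geometric_two.mul_left _), tsum_mul_left, tsum_geometric_two]
        norm_num
    _ ≤ ENNReal.ofReal 2 := by
        rw [← ENNReal.ofReal_one, ← ENNReal.ofReal_add (by norm_num) (by norm_num)]
        exact ENNReal.ofReal_le_ofReal (by norm_num)

/-- Reverse Hölder inequality between the fourth and second moments, under the tail condition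
satisfied by linear functionals of logconcave measures. -/
lemma integrable_pow_four_and_integral_le {φ : Ω → ℝ} (hφ : Measurable φ)
    (H : ∀ t : ℝ, 0 < t → ν {x | 3 * t ≤ |φ x|} * ν {x | |φ x| < t} ≤ ν {x | t ≤ |φ x|} ^ 2)
    (h2 : Integrable (fun x => φ x ^ 2) ν) :
    Integrable (fun x => φ x ^ 4) ν ∧
      ∫ x, φ x ^ 4 ∂ν ≤ (2 * 18 ^ 4) * (∫ x, φ x ^ 2 ∂ν) ^ 2 := by
  set m := ∫ x, φ x ^ 2 ∂ν with hm
  have hm0 : 0 ≤ m := integral_nonneg fun x => sq_nonneg _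
  rcases hm0.eq_or_lt with h0 | hpos
  · have hz : (fun x => φ x ^ 4) =ᵐ[ν] 0 := by
      have := (integral_eq_zero_iff_of_nonneg (fun x => sq_nonneg (φ x)) h2).1 h0.symm
      filter_upwards [this] with x hx
      have : φ x = 0 := by simpa using hx
      simp [this]
    exact ⟨(integrable_zero _ _ _).congr hz.symm, by rw [integral_congr_ae hz]; simp; positivity⟩
  set s := 18 * √m with hs
  have hs0 : 0 < s := by positivity
  have hs2 : s ^ 2 = 324 * m := by rw [hs, mul_pow, Real.sq_sqrt hm0]; norm_num
  have scale : ∀ t x, (t ≤ |φ x / s| ↔ s * t ≤ |φ x|) := fun t x => by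
    rw [abs_div, abs_of_pos hs0, le_div_iff₀ hs0, mul_comm]
  have main : ∫⁻ x, ENNReal.ofReal ((φ x / s) ^ 4) ∂ν ≤ ENNReal.ofReal 2 := by
    refine lintegral_pow_four_le_of_tail (hφ.div_const s) (fun t ht => ?_) ?_
    · have := H (s * t) (by positivity)
      simp only [← not_le, scale] at this ⊢
      rwa [mul_left_comm]
    · have hmk := mul_meas_ge_le_integral_of_nonneg (.of_forall fun x => sq_nonneg (φ x)) h2 (s ^ 2)
      have e : {x | s ^ 2 ≤ φ x ^ 2} = {x | 1 ≤ |φ x / s|} := by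
        ext x
        simp only [Set.mem_ofPred_eq, scale, mul_one]
        rw [sq_le_sq, abs_of_pos hs0]
      rw [e, ← hm, hs2] at hmk
      nlinarith
  have hm4 : AEStronglyMeasurable (fun x => (φ x / s) ^ 4) ν :=
    ((hφ.div_const s).pow_const 4).aestronglyMeasurable
  have hnn : 0 ≤ᵐ[ν] fun x => (φ x / s) ^ 4 := .of_forall fun x => by positivity
  have int : Integrable (fun x => (φ x / s) ^ 4) ν := by
    refine ⟨hm4, ?_⟩
    rw [hasFiniteIntegral_iff_ofReal hnn]
    exact main.trans_lt ENNReal.ofReal_lt_top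
  have eqv : (fun x => φ x ^ 4) = fun x => s ^ 4 * (φ x / s) ^ 4 := by
    ext x; field_simp
  have bd : ∫ x, (φ x / s) ^ 4 ∂ν ≤ 2 := by
    rw [integral_eq_lintegral_of_nonneg_ae hnn hm4]
    exact ENNReal.toReal_le_of_le_ofReal (by norm_num) main
  rw [eqv]
  refine ⟨int.const_mul _, ?_⟩
  rw [integral_const_mul]
  have : s ^ 4 = 18 ^ 4 * m ^ 2 := by rw [show s ^ 4 = (s ^ 2) ^ 2 by ring, hs2]; ring
  rw [this]
  nlinarith [sq_nonneg m]

end Moments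

lemma abs_integral_mul_le_sqrt_mul_sqrt {Ω : Type*} [MeasurableSpace Ω] {ν : Measure Ω}
    {f g : Ω → ℝ} (hf : MemLp f 2 ν) (hg : MemLp g 2 ν) :
    |∫ x, f x * g x ∂ν| ≤ √(∫ x, f x ^ 2 ∂ν) * √(∫ x, g x ^ 2 ∂ν) := by
  have h := integral_mul_norm_le_Lp_mul_Lq (μ := ν) (f := f) (g := g)
    Real.HolderConjugate.two_two (by simpa using hf) (by simpa using hg)
  simp only [Real.norm_eq_abs, Real.rpow_two, sq_abs, ← Real.sqrt_eq_rpow] at h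
  calc |∫ x, f x * g x ∂ν| ≤ ∫ x, |f x * g x| ∂ν := abs_integral_le_integral_abs
    _ ≤ _ := by simpa only [abs_mul] using h

/-- The spectral norm bounds the quadratic form. -/
lemma quadForm_le_largestEigenvalue {n : ℕ} (A : Matrix (Fin n) (Fin n) ℝ) (v : Fin n → ℝ) :
    ∑ i, ∑ j, v i * A i j * v j ≤ largestEigenvalue A * ∑ i, v i ^ 2 := by
  have hbdd : BddAbove {r : ℝ | ∃ v : Fin n → ℝ, (∑ i, (v i) ^ 2) = 1 ∧
      r = ∑ i, ∑ j, v i * A i j * v j} := by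
    refine ⟨∑ i, ∑ j, |A i j|, ?_⟩
    rintro r ⟨w, hw, rfl⟩
    have hw1 : ∀ i, |w i| ≤ 1 := fun i => by
      rw [← sq_le_one_iff_abs_le_one, ← hw]
      exact Finset.single_le_sum (f := fun i => w i ^ 2) (fun i _ => sq_nonneg _)
        (Finset.mem_univ i)
    refine Finset.sum_le_sum fun i _ => Finset.sum_le_sum fun j _ => ?_
    calc w i * A i j * w j ≤ |w i * A i j * w j| := le_abs_self _
      _ = |w i| * |A i j| * |w j| := by rw [abs_mul, abs_mul]
      _ ≤ 1 * |A i j| * 1 := by gcongr <;> exact hw1 _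
      _ = |A i j| := by ring
  have hs0 : 0 ≤ ∑ i, v i ^ 2 := Finset.sum_nonneg fun i _ => sq_nonneg _
  rcases hs0.eq_or_lt with h0 | hpos
  · have hv : ∀ i, v i = 0 := fun i => by
      have := (Finset.sum_eq_zero_iff_of_nonneg fun i _ => sq_nonneg (v i)).1 h0.symm i
        (Finset.mem_univ i)
      simpa using this
    simp [hv]
  · set c := √(∑ i, v i ^ 2) with hc
    have hc2 : c ^ 2 = ∑ i, v i ^ 2 := Real.sq_sqrt hs0
    have hcpos : 0 < c := Real.sqrt_pos.2 hpos
    have h := le_csSup hbdd ⟨fun i => v i / c, by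
      simp only [div_pow, ← Finset.sum_div, ← hc2]; exact div_self (by positivity), rfl⟩
    have e : ∑ i, ∑ j, v i / c * A i j * (v j / c) =
        (∑ i, ∑ j, v i * A i j * v j) / c ^ 2 := by
      simp only [Finset.sum_div]
      refine Finset.sum_congr rfl fun i _ => Finset.sum_congr rfl fun j _ => ?_
      field_simp
    rw [e, hc2, div_le_iff₀ hpos] at h
    exact h

open scoped MatrixOrder Matrix.Norms.L2Operator in
lemma Matrix.PosSemidef.exists_eq_conjTranspose_mul_self {n : ℕ} {A : Matrix (Fin n) (Fin n) ℝ}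
    (hA : A.PosSemidef) : ∃ B : Matrix (Fin n) (Fin n) ℝ, A = B.conjTranspose * B :=
  CStarAlgebra.nonneg_iff_eq_star_mul_self.1 hA.nonneg

section SecondMoment

variable {n : ℕ} {ν : Measure (EuclideanSpace ℝ (Fin n))} {m : EuclideanSpace ℝ (Fin n)}
  {A : Matrix (Fin n) (Fin n) ℝ}

lemma memLp_sum_mul_coord (hν : MemLp (fun x => x - m) 2 ν) (b : Fin n → ℝ) :
    MemLp (fun x => ∑ i, b i * (x i - m i)) 2 ν := by
  refine memLp_finsetSum _ fun i _ => MemLp.const_mul ?_ _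
  exact (EuclideanSpace.proj (𝕜 := ℝ) i).comp_memLp' hν

lemma integral_sum_mul_coord_sq (hν : MemLp (fun x => x - m) 2 ν)
    (hA : ∀ i j, A i j = ∫ x, (x i - m i) * (x j - m j) ∂ν) (b : Fin n → ℝ) :
    ∫ x, (∑ i, b i * (x i - m i)) ^ 2 ∂ν = ∑ i, ∑ j, b i * A i j * b j := by
  have hc : ∀ i, MemLp (fun x : EuclideanSpace ℝ (Fin n) => x i - m i) 2 ν := fun i =>
    (EuclideanSpace.proj (𝕜 := ℝ) i).comp_memLp' hν
  have hint : ∀ i j, Integrable (fun x : EuclideanSpace ℝ (Fin n) =>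
      b i * b j * ((x i - m i) * (x j - m j))) ν := fun i j =>
    ((hc i).integrable_mul (hc j)).const_mul _
  have e : ∀ x : EuclideanSpace ℝ (Fin n), (∑ i, b i * (x i - m i)) ^ 2 =
      ∑ i, ∑ j, b i * b j * ((x i - m i) * (x j - m j)) := fun x => by
    rw [sq, Finset.sum_mul_sum]
    exact Finset.sum_congr rfl fun i _ => Finset.sum_congr rfl fun j _ => by ring
  simp only [e]
  rw [integral_finsetSum _ fun i _ => integrable_finsetSum _ fun j _ => hint i j]
  refine Finset.sum_congr rfl fun i _ => ?_
  rw [integral_finsetSum _ fun j _ => hint i j]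
  refine Finset.sum_congr rfl fun j _ => ?_
  rw [integral_const_mul, hA]
  ring

lemma posSemidef_of_secondMoment (hν : MemLp (fun x => x - m) 2 ν)
    (hA : ∀ i j, A i j = ∫ x, (x i - m i) * (x j - m j) ∂ν) : A.PosSemidef := by
  refine Matrix.PosSemidef.of_dotProduct_mulVec_nonneg ?_ fun b => ?_
  · ext i j
    simp [hA, mul_comm]
  · have h : 0 ≤ ∫ x, (∑ i, b i * (x i - m i)) ^ 2 ∂ν := integral_nonneg fun x => sq_nonneg _
    rw [integral_sum_mul_coord_sq hν hA] at h
    simpa [dotProduct, Matrix.mulVec, Finset.mul_sum, mul_assoc] using h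

/-- The vector third moment bound for a measure whose linear functionals satisfy a reverse Hölder
inequality between the fourth and second moments. -/
lemma norm_integral_quadForm_smul_le (hν : MemLp (fun x => x - m) 2 ν)
    (hA : ∀ i j, A i j = ∫ x, (x i - m i) * (x j - m j) ∂ν) {K : ℝ}
    (hK : ∀ b : Fin n → ℝ, Integrable (fun x => (∑ i, b i * (x i - m i)) ^ 4) ν ∧
      ∫ x, (∑ i, b i * (x i - m i)) ^ 4 ∂ν ≤ K * (∫ x, (∑ i, b i * (x i - m i)) ^ 2 ∂ν) ^ 2) :
    ‖∫ x, (∑ i, ∑ j, (x i - m i) * A i j * (x j - m j)) • (x - m) ∂ν‖ ≤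
      √K * √(largestEigenvalue A) * Matrix.trace (A * A) := by
  obtain ⟨B, hB⟩ := (posSemidef_of_secondMoment hν hA).exists_eq_conjTranspose_mul_self
  have hBA : ∀ i j, A i j = ∑ k, B k i * B k j := fun i j => by
    simp [hB, Matrix.mul_apply]
  set φ : (Fin n → ℝ) → EuclideanSpace ℝ (Fin n) → ℝ := fun b x => ∑ i, b i * (x i - m i) with hφ
  set q : (Fin n → ℝ) → ℝ := fun b => ∑ i, ∑ j, b i * A i j * b j with hq
  have hqφ : ∀ b, ∫ x, φ b x ^ 2 ∂ν = q b := integral_sum_mul_coord_sq hν hA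
  have hq0 : ∀ b, 0 ≤ q b := fun b => hqφ b ▸ integral_nonneg fun x => sq_nonneg _
  have htr : Matrix.trace (A * A) = ∑ k, q (B k) := by
    have hsym : ∀ i j, A j i = A i j := fun i j => by simp only [hA, mul_comm]
    calc Matrix.trace (A * A) = ∑ i, ∑ j, ∑ k, B k i * A i j * B k j := by
          simp only [Matrix.trace, Matrix.diag, Matrix.mul_apply]
          refine Finset.sum_congr rfl fun i _ => Finset.sum_congr rfl fun j _ => ?_
          rw [hsym i j]
          nth_rw 2 [hBA i j]
          rw [Finset.mul_sum]
          exact Finset.sum_congr rfl fun k _ => by ring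
      _ = ∑ k, q (B k) := by
          simp only [hq]
          rw [Finset.sum_comm (s := Finset.univ (α := Fin n)) (t := Finset.univ)]
          conv_rhs => rw [Finset.sum_comm]; enter [2, i]; rw [Finset.sum_comm]
          rw [Finset.sum_comm]
  have hQ : ∀ x : EuclideanSpace ℝ (Fin n),
      ∑ i, ∑ j, (x i - m i) * A i j * (x j - m j) = ∑ k, φ (B k) x ^ 2 := fun x => by
    calc ∑ i, ∑ j, (x i - m i) * A i j * (x j - m j)
        = ∑ i, ∑ j, ∑ k, (B k i * (x i - m i)) * (B k j * (x j - m j)) := by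
          refine Finset.sum_congr rfl fun i _ => Finset.sum_congr rfl fun j _ => ?_
          rw [hBA i j, Finset.mul_sum, Finset.sum_mul]
          exact Finset.sum_congr rfl fun k _ => by ring
      _ = ∑ k, φ (B k) x ^ 2 := by
          simp only [hφ, sq, Finset.sum_mul_sum]
          conv_rhs => rw [Finset.sum_comm]; enter [2, i]; rw [Finset.sum_comm]
  have hterm : ∀ b v, Integrable (fun x => φ b x ^ 2 * φ v x) ν ∧
      |∫ x, φ b x ^ 2 * φ v x ∂ν| ≤ √K * q b * √(q v) := fun b v => by
    have h2 : MemLp (fun x => φ b x ^ 2) 2 ν := by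
      refine (memLp_two_iff_integrable_sq (f := fun x => φ b x ^ 2)
        ((memLp_sum_mul_coord hν b).aestronglyMeasurable.pow 2)).2 ?_
      simpa only [← pow_mul] using (hK b).1
    refine ⟨h2.integrable_mul (memLp_sum_mul_coord hν v), ?_⟩
    refine (abs_integral_mul_le_sqrt_mul_sqrt h2 (memLp_sum_mul_coord hν v)).trans ?_
    rw [hqφ v]
    gcongr
    rw [← Real.sqrt_sq (hq0 b), ← Real.sqrt_mul' _ (sq_nonneg _), ← hqφ b]
    refine Real.sqrt_le_sqrt ?_
    simpa only [← pow_mul] using (hK b).2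
  set V := ∫ x, (∑ i, ∑ j, (x i - m i) * A i j * (x j - m j)) • (x - m) ∂ν with hV
  have htr0 : 0 ≤ Matrix.trace (A * A) := htr ▸ Finset.sum_nonneg fun k _ => hq0 _
  by_cases hint : Integrable (fun x : EuclideanSpace ℝ (Fin n) =>
    (∑ i, ∑ j, (x i - m i) * A i j * (x j - m j)) • (x - m)) ν
  swap
  · rw [hV, integral_undef hint, norm_zero]; positivity
  have hVV : ‖V‖ ^ 2 = ∑ k, ∫ x, φ (B k) x ^ 2 * φ V x ∂ν := by
    rw [← real_inner_self_eq_norm_sq, ← integral_finsetSum _ fun k _ => (hterm (B k) V).1]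
    refine (integral_inner hint V).symm.trans ?_
    refine integral_congr_ae (.of_forall fun x => ?_)
    simp only [hQ, ← Finset.sum_mul]
    rw [inner_smul_right]
    simp [PiLp.inner_apply, hφ, mul_comm]
  have hqV : √(q V) ≤ √(largestEigenvalue A) * ‖V‖ := by
    rw [EuclideanSpace.norm_eq, ← Real.sqrt_mul' _ (by positivity)]
    simpa using Real.sqrt_le_sqrt (quadForm_le_largestEigenvalue A V)
  have hle : ‖V‖ ^ 2 ≤ (√K * √(largestEigenvalue A) * Matrix.trace (A * A)) * ‖V‖ := by
    calc ‖V‖ ^ 2 ≤ ∑ k, √K * q (B k) * √(q V) := by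
          rw [hVV]
          exact Finset.sum_le_sum fun k _ => (le_abs_self _).trans (hterm _ _).2
      _ = √K * Matrix.trace (A * A) * √(q V) := by
          rw [htr, Finset.mul_sum, Finset.sum_mul]
      _ ≤ √K * Matrix.trace (A * A) * (√(largestEigenvalue A) * ‖V‖) := by gcongr
      _ = _ := by ring
  rcases (norm_nonneg V).eq_or_lt with h0 | hpos
  · rw [← h0]; positivity
  · rw [sq] at hle
    exact le_of_mul_le_mul_right hle hpos

end SecondMoment

/-- there is a universal constant `C > 0` such that every logconcave
probability density `p` on `ℝⁿ` with mean `μ` and covariance matrix `A` satisfies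
`‖E_{x∼p} (x-μ) ((x-μ)ᵀ A (x-μ))‖₂ ≤ C ‖A‖_op^{1/2} tr(A²)`. -/
theorem logconcave_vector_moment_bound :
    ∃ C : ℝ, 0 < C ∧
      ∀ (n : ℕ) (p : EuclideanSpace ℝ (Fin n) → ℝ),
        IsDensity p → IsLogConcave p →
        Integrable (fun x : EuclideanSpace ℝ (Fin n) => p x • x) →
        Integrable (fun x : EuclideanSpace ℝ (Fin n) => p x * ‖x‖ ^ 2) →
        ‖∫ x, (p x * ∑ i, ∑ j, (x i - meanOf p i) * covOf p i j * (x j - meanOf p j)) •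
            (x - meanOf p)‖ ≤
          C * Real.sqrt (largestEigenvalue (covOf p)) *
            Matrix.trace (covOf p * covOf p) := by
  refine ⟨√(2 * 18 ^ 4), by positivity, fun n p ⟨hp0, hpi, hp1⟩ hlc _ hp2 => ?_⟩
  have hpm : AEMeasurable (fun x => ENNReal.ofReal (p x)) :=
    hpi.aestronglyMeasurable.aemeasurable.ennreal_ofReal
  set ν := volume.withDensity fun x => ENNReal.ofReal (p x) with hν
  have hprob : IsProbabilityMeasure ν := by
    refine ⟨?_⟩
    rw [hν, withDensity_apply _ .univ, Measure.restrict_univ,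
      ← ofReal_integral_eq_lintegral_ofReal hpi (.of_forall hp0), hp1, ENNReal.ofReal_one]
  have hconv : ∀ {E : Type} [NormedAddCommGroup E] [NormedSpace ℝ E]
      (F : EuclideanSpace ℝ (Fin n) → E), ∫ x, F x ∂ν = ∫ x, p x • F x := by
    intro E _ _ F
    rw [hν, integral_withDensity_eq_integral_toReal_smul₀ hpm
      (.of_forall fun x => ENNReal.ofReal_lt_top)]
    simp only [ENNReal.toReal_ofReal (hp0 _)]
  have hmem : MemLp (fun x => x - meanOf p) 2 ν := by
    refine MemLp.sub ?_ (memLp_const _)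
    rw [memLp_two_iff_integrable_sq_norm measurable_id'.aestronglyMeasurable, hν,
      integrable_withDensity_iff_integrable_smul₀' hpm (.of_forall fun x => ENNReal.ofReal_lt_top)]
    simpa only [ENNReal.toReal_ofReal (hp0 _), smul_eq_mul] using hp2
  have hcov : ∀ i j, covOf p i j = ∫ x, (x i - meanOf p i) * (x j - meanOf p j) ∂ν :=
    fun i j => by rw [hconv]; rfl
  have key := norm_integral_quadForm_smul_le hmem hcov (K := 2 * 18 ^ 4) fun b => by
    have hφ : Measurable fun x : EuclideanSpace ℝ (Fin n) => ∑ i, b i * (x i - meanOf p i) := by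
      fun_prop
    refine integrable_pow_four_and_integral_le hφ (fun t _ => ?_)
      (memLp_sum_mul_coord hmem b).integrable_sq
    refine hlc.measure_mul_measure_le hp0 hpi.aestronglyMeasurable.aemeasurable
      (measurableSet_le measurable_const hφ.abs) (measurableSet_lt hφ.abs measurable_const)
      (measurableSet_le measurable_const hφ.abs) fun x hx y hy => ?_
    have e : ∑ i, b i * (((2⁻¹ : ℝ) • (x + y)) i - meanOf p i) =
        (∑ i, b i * (x i - meanOf p i) + ∑ i, b i * (y i - meanOf p i)) / 2 := by
      rw [← Finset.sum_add_distrib, Finset.sum_div]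
      refine Finset.sum_congr rfl fun i _ => ?_
      simp only [PiLp.smul_apply, PiLp.add_apply, smul_eq_mul]
      ring
    simp only [Set.mem_ofPred_eq, e] at hx hy ⊢
    rw [abs_div, abs_of_pos (two_pos : (0 : ℝ) < 2), le_div_iff₀ two_pos]
    have := abs_sub_abs_le_abs_sub (∑ i, b i * (x i - meanOf p i))
      (-∑ i, b i * (y i - meanOf p i))
    rw [abs_neg, sub_neg_eq_add] at this
    linarith
  rw [hconv] at key
  simpa only [smul_smul] using key
end
end
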